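/- Let S = R ∪ B be a bicolored point set in convex position with |R| = |B| = n ≥ 2. Then every Hamiltonian alternating cycle on S having exactly n − r(S) crossings is 1-plane. -/

import Mathlib

open scoped Classical

noncomputable section

/-- Points of the plane. -/
abbrev Pt := ℝ × ℝ

/-- Orientation determinant of the ordered triple `(a, b, c)`. -/
def det2 (a b c : Pt) : ℝ :=
  (b.1 - a.1) * (c.2 - a.2) - (b.2 - a.2) * (c.1 - a.1)

/-- Two closed segments cross: some point lies in the relative interior of both. -/
def SegCross (e f : Pt × Pt) : Prop :=
  ∃ x : Pt, x ∈ openSegment ℝ e.1 e.2 ∧ x ∈ openSegment ℝ f.1 f.2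

/-- Number of crossings (unordered pairs of crossing edges) among a list of edges. -/
def crossNum (es : List (Pt × Pt)) : ℕ :=
  ((Finset.range es.length ×ˢ Finset.range es.length).filter
    (fun ij => ij.1 < ij.2 ∧
      SegCross (es.getD ij.1 ((0, 0), (0, 0))) (es.getD ij.2 ((0, 0), (0, 0))))).card

/-- Number of other edges crossing the `i`-th edge of the list. -/
def edgeCrossCount (es : List (Pt × Pt)) (i : ℕ) : ℕ :=
  ((Finset.range es.length).filter (fun j => j ≠ i ∧
      SegCross (es.getD i ((0, 0), (0, 0))) (es.getD j ((0, 0), (0, 0))))).card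

/-- Every edge is crossed by at most one other edge. -/
def OnePlane (es : List (Pt × Pt)) : Prop :=
  ∀ i ∈ Finset.range es.length, edgeCrossCount es i ≤ 1

/-- The edges of a path given by its list of vertices. -/
def pathEdges (l : List Pt) : List (Pt × Pt) := l.zip l.tail

/-- The edges of a cycle given by its list of vertices (including the wrap-around edge). -/
def cycleEdges (l : List Pt) : List (Pt × Pt) := l.zip (l.rotate 1)

/-- An edge joining a point of `R` to a point of `B`. -/
def Bichromatic (R B : Finset Pt) (e : Pt × Pt) : Prop :=
  (e.1 ∈ R ∧ e.2 ∈ B) ∨ (e.1 ∈ B ∧ e.2 ∈ R)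

/-- A Hamiltonian alternating path on the bicolored point set `R ∪ B`
with endpoints `p` and `q`. -/
structure HamAltPath (R B : Finset Pt) (p q : Pt) where
  verts : List Pt
  nodup : verts.Nodup
  cover : verts.toFinset = R ∪ B
  head_eq : verts.head? = some p
  last_eq : verts.getLast? = some q
  alt : ∀ e ∈ pathEdges verts, Bichromatic R B e

/-- A Hamiltonian alternating cycle on the bicolored point set `R ∪ B`. -/
structure HamAltCycle (R B : Finset Pt) where
  verts : List Pt
  nodup : verts.Nodup
  cover : verts.toFinset = R ∪ B
  alt : ∀ e ∈ cycleEdges verts, Bichromatic R B e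

/-- A Hamiltonian alternating path with prescribed endpoints is optimum if it has the
minimum number of crossings among all such paths. -/
def OptimumPath (R B : Finset Pt) (p q : Pt) (P : HamAltPath R B p q) : Prop :=
  ∀ Q : HamAltPath R B p q, crossNum (pathEdges P.verts) ≤ crossNum (pathEdges Q.verts)

/-- No three points of `S` are collinear. -/
def GeneralPosition (S : Finset Pt) : Prop :=
  ∀ p ∈ S, ∀ q ∈ S, ∀ r ∈ S, p ≠ q → p ≠ r → q ≠ r → ¬ Collinear ℝ ({p, q, r} : Set Pt)

/-- Every point of `S` is a vertex (extreme point) of its convex hull. -/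
def ConvexPosition (S : Finset Pt) : Prop :=
  ∀ p ∈ S, p ∉ convexHull ℝ ((S.erase p : Finset Pt) : Set Pt)

/-- The points of `S` lying on the boundary of the convex hull of `S`
(i.e. the extreme points of `S`). -/
def hullPts (S : Finset Pt) : Finset Pt :=
  S.filter fun p => p ∉ convexHull ℝ ((S.erase p : Finset Pt) : Set Pt)

/-- Cyclic successor on `Fin m`. -/
def cycSucc {m : ℕ} (hm : 0 < m) (i : Fin m) : Fin m :=
  ⟨(i.val + 1) % m, Nat.mod_lt _ hm⟩

/-- Cyclic predecessor on `Fin m`. -/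
def cycPred {m : ℕ} (hm : 0 < m) (i : Fin m) : Fin m :=
  ⟨(i.val + (m - 1)) % m, Nat.mod_lt _ hm⟩

/-- `pt` lists points in convex position, in clockwise circular order:
every index-increasing triple is clockwise oriented. -/
def CWList {m : ℕ} (pt : Fin m → Pt) : Prop :=
  Function.Injective pt ∧
    ∀ i j k : Fin m, i < j → j < k → det2 (pt i) (pt j) (pt k) < 0

/-- `pt` is a clockwise listing of the points of `S` on the boundary of `CH(S)`. -/
def IsHullList (S : Finset Pt) {m : ℕ} (pt : Fin m → Pt) : Prop :=
  CWList pt ∧ Finset.univ.image pt = hullPts S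

/-- The number of runs of color `A` (with other color `C`) in the cyclic sequence `pt`:
a run starts at an `A`-point whose cyclic predecessor is a `C`-point; a completely
`A`-colored cycle forms a single run. -/
def runCount {m : ℕ} (hm : 0 < m) (A C : Finset Pt) (pt : Fin m → Pt) : ℕ :=
  if ∀ i : Fin m, pt i ∈ A then 1
  else (Finset.univ.filter fun i : Fin m => pt i ∈ A ∧ pt (cycPred hm i) ∈ C).card

/-- `q` is the counterclockwise radial order of the points of `T` around `r`. -/
def CCWOrder (r : Pt) {k : ℕ} (q : Fin k → Pt) (T : Finset Pt) : Prop :=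
  Function.Injective q ∧ Finset.univ.image q = T ∧
    ∀ i j : Fin k, i < j → 0 < det2 r (q i) (q j)

/-- `q` is the clockwise radial order of the points of `T` around `r`. -/
def CWOrder (r : Pt) {k : ℕ} (q : Fin k → Pt) (T : Finset Pt) : Prop :=
  Function.Injective q ∧ Finset.univ.image q = T ∧
    ∀ i j : Fin k, i < j → det2 r (q i) (q j) < 0

/-- Counting one extra point of color `A` (the center), the initial segment
`q 0, …, q j` contains equally many points of color `A` and of color `C`. -/
def BalancedAt (A C : Finset Pt) {k : ℕ} (q : Fin k → Pt) (j : Fin k) : Prop :=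
  1 + (Finset.univ.filter fun i : Fin k => i ≤ j ∧ q i ∈ A).card
    = (Finset.univ.filter fun i : Fin k => i ≤ j ∧ q i ∈ C).card

/-- `j` is the first balanced index of the sequence `q`. -/
def FirstBalanced (A C : Finset Pt) {k : ℕ} (q : Fin k → Pt) (j : Fin k) : Prop :=
  BalancedAt A C q j ∧ ∀ j' : Fin k, j' < j → ¬ BalancedAt A C q j'

/-- The triple `(R ∪ B, r, b)` is a special configuration (Definition 2.2):
(i) both neighbors of `r` on the hull boundary are red and both neighbors of `b` are
blue; (ii) in the counterclockwise and clockwise radial orders around `r`, the first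
balanced point is `b`; (iii) symmetrically around `b`, the first balanced point is `r`. -/
def SpecialConfig (R B : Finset Pt) (r b : Pt) : Prop :=
  r ∈ hullPts (R ∪ B) ∧ b ∈ hullPts (R ∪ B) ∧
  (∀ (m : ℕ) (hm : 0 < m) (pt : Fin m → Pt), IsHullList (R ∪ B) pt →
    ∀ i : Fin m,
      (pt i = r → pt (cycPred hm i) ∈ R ∧ pt (cycSucc hm i) ∈ R) ∧
      (pt i = b → pt (cycPred hm i) ∈ B ∧ pt (cycSucc hm i) ∈ B)) ∧
  (∀ (k : ℕ) (q : Fin k → Pt),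
      (CCWOrder r q ((R ∪ B).erase r) ∨ CWOrder r q ((R ∪ B).erase r)) →
      ∀ j : Fin k, FirstBalanced R B q j → q j = b) ∧
  (∀ (k : ℕ) (q : Fin k → Pt),
      (CCWOrder b q ((R ∪ B).erase b) ∨ CWOrder b q ((R ∪ B).erase b)) →
      ∀ j : Fin k, FirstBalanced B R q j → q j = r)

/-- The unordered pair `{a, b}` occurs as an edge of the list `es`. -/
def IsEdgeOf (es : List (Pt × Pt)) (a b : Pt) : Prop := (a, b) ∈ es ∨ (b, a) ∈ es

/-- The clockwise cyclic interval of indices from `a` to `b`, inclusive. -/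
def cycIdx {m : ℕ} (hm : 0 < m) (a b : Fin m) : Finset (Fin m) :=
  (Finset.range ((b.val + m - a.val) % m + 1)).image
    fun t => (⟨(a.val + t) % m, Nat.mod_lt _ hm⟩ : Fin m)

/-- `x` lies strictly between `p` and `q`. -/
def Ins (p q x : ℕ) : Prop := (p < x ∧ x < q) ∨ (q < x ∧ x < p)

/-- `x` lies strictly outside the interval spanned by `p` and `q`. -/
def Out (p q x : ℕ) : Prop := ¬ Ins p q x ∧ x ≠ p ∧ x ≠ q

/-- The chords `pq` and `uv` of a circle, with ends given by their positions, interleave. -/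
def Crs (p q u v : ℕ) : Prop := (Ins p q u ∧ Out p q v) ∨ (Ins p q v ∧ Out p q u)

theorem Crs.symm {p q u v : ℕ} (h : Crs p q u v) : Crs u v p q := by
  unfold Crs Out Ins at *; grind (splits := 40)

theorem Crs.left_comm {p q u v : ℕ} (h : Crs p q u v) : Crs q p u v := by
  unfold Crs Out Ins at *; grind (splits := 40)

theorem Crs.right_comm {p q u v : ℕ} (h : Crs p q u v) : Crs p q v u := Or.symm h

theorem Crs.or_of_exchange {p q r s u v : ℕ} (h : Crs p q r s) (h' : Crs u v p s) :
    Crs u v p q ∨ Crs u v r s := by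
  unfold Crs Out Ins at *; grind (splits := 40)

theorem Crs.of_exchange {p q r s u v : ℕ} (h : Crs p q r s) (h₁ : Crs u v p s)
    (h₂ : Crs u v r q) : Crs u v p q := by
  unfold Crs Out Ins at *; grind (splits := 40)

theorem Crs.not_exchange {p q r s : ℕ} (h : Crs p q r s) : ¬ Crs p s r q := by
  unfold Crs Out Ins at *; grind (splits := 40)

/-- The chord `uv` crosses `pq` with its inner end between `x` and `y`. -/
def CrsBetween (p q x y u v : ℕ) : Prop :=
  (Ins p q u ∧ Out p q v ∧ (Ins x y u ∨ u = x ∨ u = y)) ∨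
    (Ins p q v ∧ Out p q u ∧ (Ins x y v ∨ v = x ∨ v = y))

theorem crs_parallel_inner {p q x y x' y' u v : ℕ} (hx : Ins p q x) (hy : Out p q y)
    (hx' : Out p q x') (hy' : Ins p q y') (hn : ¬ Crs x y x' y') (hc : x ≠ y') (hc' : x' ≠ y)
    (h : Crs u v x y') : Crs u v x y ∨ Crs u v x' y' ∨ CrsBetween p q x y' u v := by
  unfold CrsBetween Crs Out Ins at *; grind (splits := 60)

theorem crs_parallel_outer {p q x y x' y' u v : ℕ} (hx : Ins p q x) (hy : Out p q y)
    (hx' : Out p q x') (hy' : Ins p q y') (hc : x ≠ y') (hc' : x' ≠ y)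
    (h : Crs u v x' y) : Crs u v x y ∨ Crs u v x' y' ∨ CrsBetween p q x y' u v := by
  unfold CrsBetween Crs Out Ins at *; grind (splits := 60)

theorem crs_parallel_both {p q x y x' y' u v : ℕ} (hx : Ins p q x) (hy : Out p q y)
    (hx' : Out p q x') (hy' : Ins p q y') (h : Crs u v x y') (h' : Crs u v x' y) :
    (Crs u v x y ∧ Crs u v x' y') ∨ CrsBetween p q x y' u v := by
  unfold CrsBetween Crs Out Ins at *; grind (splits := 60)

section QuotCard

variable {V E : Type*}

/-- The relation `r` together with the single pair `(u, v)`. -/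
def AddPair (r : V → V → Prop) (u v : V) (x y : V) : Prop := r x y ∨ (x = u ∧ y = v)

theorem card_quot_le_of_imp [Finite V] {r s : V → V → Prop}
    (h : ∀ x y, r x y → Quot.mk s x = Quot.mk s y) : Nat.card (Quot s) ≤ Nat.card (Quot r) := by
  refine Nat.card_le_card_of_surjective (Quot.lift (Quot.mk s) h) ?_
  rintro ⟨x⟩
  exact ⟨Quot.mk r x, rfl⟩

theorem AddPair.mk_eq (r : V → V → Prop) (u v : V) :
    Quot.mk (AddPair r u v) u = Quot.mk (AddPair r u v) v :=
  Quot.sound (Or.inr ⟨rfl, rfl⟩)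

theorem card_quot_addPair_le [Finite V] (r : V → V → Prop) (u v : V) :
    Nat.card (Quot (AddPair r u v)) ≤ Nat.card (Quot r) :=
  card_quot_le_of_imp fun _ _ h => Quot.sound (Or.inl h)

/-- A retraction of the finer quotient, through the coarser one, onto the classes
different from that of `u`. -/
theorem exists_addPair_section (r : V → V → Prop) (u v : V) :
    ∃ F : Quot (AddPair r u v) → Quot r,
      ∀ w, F (Quot.mk _ w) = if Quot.mk r w = Quot.mk r u then Quot.mk r v else Quot.mk r w := by
  refine ⟨Quot.lift (fun w => if Quot.mk r w = Quot.mk r u then Quot.mk r v else Quot.mk r w) ?_,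
    fun _ => rfl⟩
  rintro x y (h | ⟨rfl, rfl⟩)
  · simp only [Quot.sound h]
  · simp

theorem card_quot_le_addPair_add_one [Finite V] (r : V → V → Prop) (u v : V) :
    Nat.card (Quot r) ≤ Nat.card (Quot (AddPair r u v)) + 1 := by
  obtain ⟨F, hF⟩ := exists_addPair_section r u v
  have hs : Function.Surjective
      (fun o : Option (Quot (AddPair r u v)) => o.elim (Quot.mk r u) F) := by
    rintro ⟨w⟩
    by_cases h : Quot.mk r w = Quot.mk r u
    · exact ⟨none, h.symm⟩
    · exact ⟨some (Quot.mk _ w), by simp [hF, h]⟩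
  simpa using Nat.card_le_card_of_surjective _ hs

theorem card_quot_le_addPair [Finite V] (r : V → V → Prop) {u v : V} (h : Quot.mk r u = Quot.mk r v) :
    Nat.card (Quot r) ≤ Nat.card (Quot (AddPair r u v)) := by
  refine card_quot_le_of_imp ?_
  rintro x y (hxy | ⟨rfl, rfl⟩)
  exacts [Quot.sound hxy, h]

theorem card_quot_addPair_lt [Finite V] (r : V → V → Prop) {u v : V} (h : Quot.mk r u ≠ Quot.mk r v) :
    Nat.card (Quot (AddPair r u v)) + 1 ≤ Nat.card (Quot r) := by
  obtain ⟨F, hF⟩ := exists_addPair_section r u v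
  have hinj : Function.Injective F := by
    rintro ⟨x⟩ ⟨y⟩ hxy
    have key : ∀ w, Quot.mk (AddPair r u v) w =
        Quot.map (rb := AddPair r u v) id (fun _ _ h => Or.inl h) (F (Quot.mk _ w)) := by
      intro w
      rw [hF]
      split_ifs with hw
      · have := congrArg (Quot.map (rb := AddPair r u v) id (fun _ _ h => Or.inl h)) hw
        exact this.trans (AddPair.mk_eq r u v)
      · rfl
    rw [key x, key y]
    exact congrArg _ hxy
  have hmiss : Quot.mk r u ∉ Set.range F := by
    rintro ⟨⟨w⟩, hw⟩
    rw [hF] at hw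
    split_ifs at hw with hwu
    exacts [h hw.symm, hwu hw]
  have : Function.Injective
      (fun o : Option (Quot (AddPair r u v)) => o.elim (Quot.mk r u) F) := by
    rintro (_ | x) (_ | y) hxy
    · rfl
    · exact (hmiss ⟨y, hxy.symm⟩).elim
    · exact (hmiss ⟨x, hxy⟩).elim
    · exact congrArg some (hinj hxy)
  simpa using Nat.card_le_card_of_injective _ this

/-- Two vertices are linked when they are the ends `a x` and `b x` of an edge `x`. -/
def Link (a b : E → V) (v w : V) : Prop := ∃ x, a x = v ∧ b x = w

theorem mk_link (a b : E → V) (x : E) : Quot.mk (Link a b) (a x) = Quot.mk (Link a b) (b x) :=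
  Quot.sound ⟨x, rfl, rfl⟩

theorem card_addPair_swap_le [Finite V] (a b : E → V) (e f : E) :
    Nat.card (Quot (AddPair (Link a (b ∘ Equiv.swap e f)) (a e) (a f))) ≤
      Nat.card (Quot (AddPair (Link a b) (a e) (a f))) := by
  refine card_quot_le_of_imp ?_
  have hef := AddPair.mk_eq (Link a (b ∘ Equiv.swap e f)) (a e) (a f)
  rintro x y (⟨z, rfl, rfl⟩ | ⟨rfl, rfl⟩)
  · have h : ∀ z, Quot.mk (AddPair (Link a (b ∘ Equiv.swap e f)) (a e) (a f)) (a z) =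
        Quot.mk _ (b (Equiv.swap e f z)) := fun z => Quot.sound (Or.inl ⟨z, rfl, rfl⟩)
    have h' := h (Equiv.swap e f z)
    rw [Equiv.swap_apply_self] at h'
    rw [← h']
    rcases eq_or_ne z e with rfl | hze
    · rw [Equiv.swap_apply_left, hef]
    rcases eq_or_ne z f with rfl | hzf
    · rw [Equiv.swap_apply_right, hef]
    · rw [Equiv.swap_apply_of_ne_of_ne hze hzf]
  · exact hef

theorem card_addPair_swap [Finite V] (a b : E → V) (e f : E) :
    Nat.card (Quot (AddPair (Link a (b ∘ Equiv.swap e f)) (a e) (a f))) =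
      Nat.card (Quot (AddPair (Link a b) (a e) (a f))) := by
  refine le_antisymm (card_addPair_swap_le a b e f) ?_
  have h := card_addPair_swap_le a (b ∘ Equiv.swap e f) e f
  have hb : (b ∘ Equiv.swap e f) ∘ Equiv.swap e f = b := by
    funext x; simp
  rwa [hb] at h

end QuotCard

/-- A bipartite 2-regular multigraph with edge set `E` whose vertices `0, …, m - 1` lie in this
order on a circle and are colored red or not.  The edge `x` joins the red vertex `a x` to the
vertex `b x`; the other edge at `a x` is `α x` and the other edge at `b x` is `β x`. -/
structure ChordSystem (m : ℕ) (E : Type) (red : Fin m → Prop) where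
  a : E → Fin m
  b : E → Fin m
  α : E → E
  β : E → E
  red_a : ∀ x, red (a x)
  not_red_b : ∀ x, ¬ red (b x)
  surj_a : ∀ v, red v → ∃ x, a x = v
  surj_b : ∀ v, ¬ red v → ∃ x, b x = v
  α_α : ∀ x, α (α x) = x
  β_β : ∀ x, β (β x) = x
  α_ne : ∀ x, α x ≠ x
  β_ne : ∀ x, β x ≠ x
  a_eq : ∀ x y, a x = a y ↔ y = x ∨ y = α x
  b_eq : ∀ x y, b x = b y ↔ y = x ∨ y = β x

namespace ChordSystem

variable {m : ℕ} {E : Type} {red : Fin m → Prop} (S : ChordSystem m E red)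

theorem a_α (x : E) : S.a (S.α x) = S.a x := ((S.a_eq _ _).2 (Or.inr rfl)).symm

theorem b_β (x : E) : S.b (S.β x) = S.b x := ((S.b_eq _ _).2 (Or.inr rfl)).symm

theorem a_ne_b (x y : E) : S.a x ≠ S.b y := fun h => S.not_red_b y (h ▸ S.red_a x)

/-- The component of a vertex. -/
def comp (v : Fin m) : Quot (Link S.a S.b) := Quot.mk _ v

/-- The number of components. -/
def numComp : ℕ := Nat.card (Quot (Link S.a S.b))

theorem comp_a (x : E) : S.comp (S.a x) = S.comp (S.b x) := mk_link _ _ _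

theorem comp_β (x : E) : S.comp (S.a (S.β x)) = S.comp (S.a x) := by
  rw [S.comp_a, S.b_β, S.comp_a]

/-- Exchange the `b`-ends of the edges `e` and `f`. -/
def swap (e f : E) : ChordSystem m E red where
  a := S.a
  b := S.b ∘ Equiv.swap e f
  α := S.α
  β := fun x => Equiv.swap e f (S.β (Equiv.swap e f x))
  red_a := S.red_a
  not_red_b _ := S.not_red_b _
  surj_a := S.surj_a
  surj_b v hv := by
    obtain ⟨x, rfl⟩ := S.surj_b v hv
    exact ⟨Equiv.swap e f x, by simp⟩
  α_α := S.α_α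
  β_β x := by simp [S.β_β]
  α_ne := S.α_ne
  β_ne x h := S.β_ne (Equiv.swap e f x) (by
    have := congrArg (Equiv.swap e f) h
    simpa using this)
  a_eq := S.a_eq
  b_eq x y := by
    simp only [Function.comp, S.b_eq, EmbeddingLike.apply_eq_iff_eq]
    refine or_congr Iff.rfl ⟨fun h => ?_, fun h => ?_⟩
    · rw [← h]; simp
    · rw [h]; simp

theorem swap_b_left (e f : E) : (S.swap e f).b e = S.b f := by simp [swap]

theorem swap_b_right (e f : E) : (S.swap e f).b f = S.b e := by simp [swap]

theorem swap_b_of_ne {e f x : E} (he : x ≠ e) (hf : x ≠ f) : (S.swap e f).b x = S.b x := by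
  simp [swap, Equiv.swap_apply_of_ne_of_ne he hf]

theorem numComp_swap_le (e f : E) : (S.swap e f).numComp ≤ S.numComp + 1 :=
  (card_quot_le_addPair_add_one _ (S.a e) (S.a f)).trans <|
    Nat.succ_le_succ <| (card_addPair_swap S.a S.b e f).le.trans (card_quot_addPair_le _ _ _)

theorem numComp_swap_le_of_comp_eq {e f : E}
    (h : (S.swap e f).comp (S.a e) = (S.swap e f).comp (S.a f)) :
    (S.swap e f).numComp ≤ S.numComp :=
  (card_quot_le_addPair _ h).trans <|
    (card_addPair_swap S.a S.b e f).le.trans (card_quot_addPair_le _ _ _)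

/-- Exchanging ends of edges in different components merges these components. -/
theorem comp_swap_eq [Fintype E] {e f : E} (h : S.comp (S.a e) ≠ S.comp (S.a f)) :
    (S.swap e f).comp (S.a e) = (S.swap e f).comp (S.a f) := by
  by_contra h'
  have hA : ∀ x, (S.swap e f).comp (S.a x) = (S.swap e f).comp ((S.swap e f).b x) :=
    (S.swap e f).comp_a
  set Y : Finset E := Finset.univ.filter fun x =>
    (S.swap e f).comp (S.a x) = (S.swap e f).comp (S.a e) ∧ S.comp (S.a x) = S.comp (S.a e)
    with hY
  have hYe : e ∈ Y := by simp [hY]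
  have h1 : ∑ x ∈ Y, (1 : ZMod 2) = 0 := by
    refine Finset.sum_involution (fun x _ => S.α x) ?_ ?_ ?_ ?_
    · intros; decide
    · intro x _ _; exact S.α_ne x
    · intro x hx
      simpa [hY, S.a_α] using hx
    · intro x _; exact S.α_α x
  have h2 : ∑ x ∈ Y.erase e, (1 : ZMod 2) = 0 := by
    refine Finset.sum_involution (fun x _ => S.β x) ?_ ?_ ?_ ?_
    · intros; decide
    · intro x _ _; exact S.β_ne x
    · intro x hx
      simp only [hY, Finset.mem_erase, Finset.mem_filter, Finset.mem_univ, true_and] at hx ⊢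
      obtain ⟨hxe, hx1, hx2⟩ := hx
      have hxf : x ≠ f := by rintro rfl; exact h hx2.symm
      have hbx := S.swap_b_of_ne hxe hxf
      have hβf : S.β x ≠ f := by
        intro hh; apply h; rw [← hh, S.comp_β, hx2]
      have hβe : S.β x ≠ e := by
        intro hh
        apply h'
        rw [← hx1, hA x, hbx, hA f, S.swap_b_right, ← hh, S.b_β]
      refine ⟨hβe, ?_, by rw [S.comp_β, hx2]⟩
      rw [hA, S.swap_b_of_ne hβe hβf, S.b_β, ← hbx, ← hA, hx1]
    · intro x _; exact S.β_β x
  rw [← Finset.add_sum_erase _ _ hYe, h2] at h1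
  exact absurd h1 (by decide)

theorem numComp_swap_lt [Fintype E] {e f : E} (h : S.comp (S.a e) ≠ S.comp (S.a f)) :
    (S.swap e f).numComp + 1 ≤ S.numComp :=
  le_trans (Nat.succ_le_succ <| (card_quot_le_addPair _ (S.comp_swap_eq h)).trans
    (card_addPair_swap S.a S.b e f).le) (card_quot_addPair_lt _ h)

/-- Exchanging ends of two edges traversed in opposite directions does not disconnect them. -/
theorem comp_swap_eq_of_sign [Fintype E] {e f : E} {s : E → ℤ} (hα : ∀ x, s (S.α x) = - s x)
    (hβ : ∀ x, s (S.β x) = - s x) (hs : ∀ x, s x ≠ 0)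
    (hef : s f = - s e) (hb : S.b e ≠ S.b f) :
    (S.swap e f).comp (S.a e) = (S.swap e f).comp (S.a f) := by
  by_contra h'
  have hA : ∀ x, (S.swap e f).comp (S.a x) = (S.swap e f).comp ((S.swap e f).b x) :=
    (S.swap e f).comp_a
  set X : Finset E := Finset.univ.filter fun x =>
    (S.swap e f).comp (S.a x) = (S.swap e f).comp (S.a e) with hX
  have hβfe : S.β f ≠ e := by
    intro hh; apply hb; rw [← hh, S.b_β]
  have hXe : e ∈ X := by simp [hX]
  have hXf : S.β f ∈ X.erase e := by
    simp only [hX, Finset.mem_erase, Finset.mem_filter, Finset.mem_univ, true_and]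
    refine ⟨hβfe, ?_⟩
    rw [hA, S.swap_b_of_ne hβfe (S.β_ne f), S.b_β, hA e, S.swap_b_left]
  have h1 : ∑ x ∈ X, s x = 0 := by
    refine Finset.sum_involution (fun x _ => S.α x) ?_ ?_ ?_ ?_
    · intro x _; rw [hα]; ring
    · intro x _ _; exact S.α_ne x
    · intro x hx
      simpa [hX, S.a_α] using hx
    · intro x _; exact S.α_α x
  have h2 : ∑ x ∈ (X.erase e).erase (S.β f), s x = 0 := by
    refine Finset.sum_involution (fun x _ => S.β x) ?_ ?_ ?_ ?_
    · intro x _; rw [hβ]; ring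
    · intro x _ _; exact S.β_ne x
    · intro x hx
      simp only [hX, Finset.mem_erase, Finset.mem_filter, Finset.mem_univ, true_and] at hx ⊢
      obtain ⟨hxβ, hxe, hx1⟩ := hx
      have hxf : x ≠ f := by rintro rfl; exact h' hx1.symm
      have hbx := S.swap_b_of_ne hxe hxf
      have hβf : S.β x ≠ f := by
        intro hh; apply hxβ; rw [← hh, S.β_β]
      have hβe : S.β x ≠ e := by
        intro hh
        apply h'
        rw [← hx1, hA x, hbx, hA f, S.swap_b_right, ← hh, S.b_β]
      refine ⟨?_, hβe, ?_⟩
      · intro hh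
        apply hxf
        rw [← S.β_β x, hh, S.β_β]
      · rw [hA, S.swap_b_of_ne hβe hβf, S.b_β, ← hbx, ← hA, hx1]
    · intro x _; exact S.β_β x
  rw [← Finset.add_sum_erase _ _ hXe, ← Finset.add_sum_erase _ _ hXf, h2, hβ, hef] at h1
  have := hs e
  omega

end ChordSystem

theorem cycPred_val {m : ℕ} (hm : 0 < m) (i : Fin m) :
    (cycPred hm i).val = if i.val = 0 then m - 1 else i.val - 1 := by
  have := i.isLt
  unfold cycPred
  split_ifs with h
  · simp only [h, zero_add]
    exact Nat.mod_eq_of_lt (by omega)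
  · simp only
    rw [show i.val + (m - 1) = (i.val - 1) + m by omega, Nat.add_mod_right]
    exact Nat.mod_eq_of_lt (by omega)

namespace ChordSystem

variable {m : ℕ} {E : Type} {red : Fin m → Prop} (S : ChordSystem m E red)

/-- The edges `x` and `y` cross. -/
def Cross (x y : E) : Prop := Crs (S.a x) (S.b x) (S.a y) (S.b y)

/-- The indicator of a proposition. -/
def ind (p : Prop) : ℤ := if p then 1 else 0

theorem ind_true {p : Prop} (h : p) : ind p = 1 := if_pos h

theorem ind_false {p : Prop} (h : ¬ p) : ind p = 0 := if_neg h

theorem exists_edge_of_comp_eq {u v : Fin m} (h : S.comp u = S.comp v) (P : Fin m → Prop)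
    (hu : P u) (hv : ¬ P v) :
    ∃ x, S.comp (S.a x) = S.comp u ∧ ((P (S.a x) ∧ ¬ P (S.b x)) ∨ (¬ P (S.a x) ∧ P (S.b x))) := by
  by_contra hne
  push Not at hne
  let g : Quot (Link S.a S.b) → Prop := Quot.lift (fun w => S.comp w = S.comp u ∧ P w) (by
    rintro _ _ ⟨x, rfl, rfl⟩
    have hc := S.comp_a x
    refine propext ⟨fun hx => ⟨hc ▸ hx.1, ((hne x hx.1).1 hx.2)⟩, fun hx => ⟨hc ▸ hx.1, ?_⟩⟩
    by_contra hP
    exact (hne x (hc ▸ hx.1)).2 hP hx.2)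
  have hg : g (S.comp u) = g (S.comp v) := congrArg g h
  have hgu : g (S.comp u) := ⟨rfl, hu⟩
  rw [hg] at hgu
  exact hv hgu.2

theorem _root_.Crs.ins_or {p q u v : ℕ} (h : Crs p q u v) :
    Ins u v p ∧ ¬ Ins u v q ∨ Ins u v q ∧ ¬ Ins u v p := by
  rcases h.symm with h | h
  exacts [Or.inl ⟨h.1, h.2.1⟩, Or.inr ⟨h.1, h.2.1⟩]

/-- Interleaved components contain crossing edges. -/
theorem exists_cross_of_comp {p q u v : Fin m} (hpq : S.comp p = S.comp q)
    (huv : S.comp u = S.comp v) (hne : S.comp p ≠ S.comp u) (h : Crs p q u v) :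
    ∃ x y, S.Cross x y := by
  wlog hin : Ins p q u generalizing u v
  · rcases h with h | h
    · exact absurd h.1 hin
    · exact this huv.symm (huv ▸ hne) (Or.inl h) h.1
  have hout : ¬ Ins p q v := by
    rcases h with h | h
    exacts [h.2.1, absurd hin h.2.1]
  obtain ⟨x, hx, hx'⟩ := S.exists_edge_of_comp_eq huv (fun w => Ins p q w) hin hout
  have hne' : ∀ w, S.comp w = S.comp u → (w : ℕ) ≠ p ∧ (w : ℕ) ≠ q := by
    refine fun w hw => ⟨fun h => hne ?_, fun h => hne ?_⟩
    · rw [← hw, Fin.ext h]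
    · rw [← hw, hpq, Fin.ext h]
  have hcr : Crs p q (S.a x) (S.b x) := by
    rcases hx' with hx' | hx'
    · exact Or.inl ⟨hx'.1, hx'.2, hne' _ (by rw [← S.comp_a, hx])⟩
    · exact Or.inr ⟨hx'.2, hx'.1, hne' _ hx⟩
  have key : ∀ p q : Fin m, S.comp p = S.comp q → S.comp p ≠ S.comp u →
      Ins (S.a x) (S.b x) p → ¬ Ins (S.a x) (S.b x) q → ∃ x y, S.Cross x y := by
    intro p q hpq hne h1 h2
    obtain ⟨y, hy, hy'⟩ := S.exists_edge_of_comp_eq hpq (fun w => Ins (S.a x) (S.b x) w) h1 h2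
    have hne'' : ∀ w, S.comp w = S.comp p → (w : ℕ) ≠ S.a x ∧ (w : ℕ) ≠ S.b x := by
      refine fun w hw => ⟨fun h => hne ?_, fun h => hne ?_⟩
      · rw [← hw, Fin.ext h, hx]
      · rw [← hw, Fin.ext h, ← S.comp_a, hx]
    refine ⟨x, y, ?_⟩
    rcases hy' with hy' | hy'
    · exact Or.inl ⟨hy'.1, hy'.2, hne'' _ (by rw [← S.comp_a, hy])⟩
    · exact Or.inr ⟨hy'.2, hy'.1, hne'' _ hy⟩
  rcases hcr.ins_or with h | h
  · exact key p q hpq hne h.1 h.2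
  · exact key q p hpq.symm (hpq ▸ hne) h.1 h.2

theorem not_crs_of_comp (hS : ∀ x y, ¬ S.Cross x y)
    {p q u v : Fin m} (hpq : S.comp p = S.comp q)
    (huv : S.comp u = S.comp v) (hne : S.comp p ≠ S.comp u) : ¬ Crs p q u v := fun h => by
  obtain ⟨x, y, hxy⟩ := S.exists_cross_of_comp hpq huv hne h
  exact hS x y hxy

variable [Fintype E]

/-- The number of `a`-ends minus the number of `b`-ends at the vertices satisfying `P`. -/
def excess (P : Fin m → Prop) : ℤ := ∑ x, (ind (P (S.a x)) - ind (P (S.b x)))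

theorem even_sum_a (P : Fin m → Prop) : Even (∑ x, ind (P (S.a x))) := by
  rw [← ZMod.intCast_eq_zero_iff_even]
  push_cast
  refine Finset.sum_involution (fun x _ => S.α x) ?_ ?_ ?_ ?_
  · intro x _
    rw [S.a_α]
    exact CharTwo.add_self_eq_zero _
  · intro x _ _; exact S.α_ne x
  · intro x _; exact Finset.mem_univ _
  · intro x _; exact S.α_α x

theorem even_sum_b (P : Fin m → Prop) : Even (∑ x, ind (P (S.b x))) := by
  rw [← ZMod.intCast_eq_zero_iff_even]
  push_cast
  refine Finset.sum_involution (fun x _ => S.β x) ?_ ?_ ?_ ?_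
  · intro x _
    rw [S.b_β]
    exact CharTwo.add_self_eq_zero _
  · intro x _ _; exact S.β_ne x
  · intro x _; exact Finset.mem_univ _
  · intro x _; exact S.β_β x

theorem even_excess (P : Fin m → Prop) : Even (S.excess P) := by
  unfold excess
  rw [Finset.sum_sub_distrib]
  exact (S.even_sum_a P).sub (S.even_sum_b P)

theorem excess_eq_zero (P : Fin m → Prop) (h : ∀ x, P (S.a x) ↔ P (S.b x)) : S.excess P = 0 :=
  Finset.sum_eq_zero fun x _ => by rw [propext (h x), sub_self]

theorem excess_add (P Q T : Fin m → Prop) (h : ∀ v, ind (T v) = ind (P v) + ind (Q v)) :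
    S.excess T = S.excess P + S.excess Q := by
  unfold excess
  rw [← Finset.sum_add_distrib]
  refine Finset.sum_congr rfl fun x _ => ?_
  rw [h, h]; ring

theorem excess_eq_of_red {v : Fin m} (hv : red v) : S.excess (fun w => w = v) = 2 := by
  obtain ⟨x, rfl⟩ := S.surj_a v hv
  have h : ∀ y, ind (S.a y = S.a x) - ind (S.b y = S.a x) =
      (if y = x then 1 else 0) + (if y = S.α x then 1 else 0) := by
    intro y
    rw [ind_false (S.a_ne_b x y).symm, sub_zero]
    have h1 := S.a_eq x y
    have h2 := S.α_ne x
    rcases eq_or_ne y x with rfl | h3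
    · rw [ind_true rfl, if_pos rfl, if_neg h2.symm, add_zero]
    · rw [if_neg h3, zero_add]
      by_cases h4 : y = S.α x
      · rw [if_pos h4, ind_true (h1.2 (Or.inr h4)).symm]
      · rw [if_neg h4, ind_false fun h => (h1.1 h.symm).elim h3 h4]
  unfold excess
  rw [Finset.sum_congr rfl fun y _ => h y, Finset.sum_add_distrib]
  simp

theorem excess_eq_of_not_red {v : Fin m} (hv : ¬ red v) : S.excess (fun w => w = v) = -2 := by
  obtain ⟨x, rfl⟩ := S.surj_b v hv
  have h : ∀ y, ind (S.a y = S.b x) - ind (S.b y = S.b x) =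
      -((if y = x then 1 else 0) + (if y = S.β x then 1 else 0)) := by
    intro y
    rw [ind_false (S.a_ne_b y x), zero_sub]
    congr 1
    have h1 := S.b_eq x y
    have h2 := S.β_ne x
    rcases eq_or_ne y x with rfl | h3
    · rw [ind_true rfl, if_pos rfl, if_neg h2.symm, add_zero]
    · rw [if_neg h3, zero_add]
      by_cases h4 : y = S.β x
      · rw [if_pos h4, ind_true (h1.2 (Or.inr h4)).symm]
      · rw [if_neg h4, ind_false fun h => (h1.1 h.symm).elim h3 h4]
  unfold excess
  rw [Finset.sum_congr rfl fun y _ => h y, Finset.sum_neg_distrib, Finset.sum_add_distrib]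
  simp

/-- The height just before the vertex `v`. -/
def height (v : Fin m) : ℤ := S.excess fun w => w < v

/-- The height just after the vertex `v`. -/
def height' (v : Fin m) : ℤ := S.excess fun w => w ≤ v

theorem height'_eq (v : Fin m) : S.height' v = S.height v + S.excess (fun w => w = v) :=
  S.excess_add _ _ _ fun w => by
    unfold ind
    rcases lt_trichotomy w v with h | h | h
    · simp [h, h.le, h.ne]
    · simp [h]
    · simp [h.not_ge, h.not_gt, h.ne']

theorem height_eq_cycPred (hm : 0 < m) (i : Fin m) : S.height i = S.height' (cycPred hm i) := by
  have hv := cycPred_val hm i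
  unfold height height'
  by_cases h : i.val = 0
  · rw [if_pos h] at hv
    rw [S.excess_eq_zero, S.excess_eq_zero]
    · intro x
      have := (S.a x).isLt
      have := (S.b x).isLt
      rw [Fin.le_def, Fin.le_def]; omega
    · intro x
      rw [Fin.lt_def, Fin.lt_def]; omega
  · rw [if_neg h] at hv
    congr 1
    funext w
    rw [Fin.le_def, Fin.lt_def]
    exact propext (by omega)

/-- The level of a vertex. -/
def level (v : Fin m) : ℤ := S.height v + S.height' v

theorem level_of_red {v : Fin m} (hv : red v) :
    S.level v = 2 * S.height v + 2 ∧ S.level v = 2 * S.height' v - 2 := by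
  have := S.height'_eq v
  rw [S.excess_eq_of_red hv] at this
  unfold level
  constructor <;> linarith

theorem level_of_not_red {v : Fin m} (hv : ¬ red v) :
    S.level v = 2 * S.height v - 2 ∧ S.level v = 2 * S.height' v + 2 := by
  have := S.height'_eq v
  rw [S.excess_eq_of_not_red hv] at this
  unfold level
  constructor <;> linarith

theorem height_eq_of_lt {p q : Fin m} (h : p < q) :
    S.height q = S.height' p + S.excess (fun w => Ins p q w) :=
  S.excess_add _ _ _ fun w => by
    rw [Fin.lt_def] at h
    unfold ind Ins
    simp only [Fin.lt_def, Fin.le_def]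
    split_ifs <;> omega

theorem excess_ins_eq_zero (hS : ∀ x y, ¬ S.Cross x y)
    (x : E) : S.excess (fun w => Ins (S.a x) (S.b x) w) = 0 := by
  have hx : ¬ Ins (S.a x) (S.b x) (S.a x) ∧ ¬ Ins (S.a x) (S.b x) (S.b x) := by
    unfold Ins; omega
  have hout : ∀ v w : Fin m, Out (S.a x) (S.b x) v ∨ Ins (S.a x) (S.b x) v ∨ v = S.a x ∨
      v = S.b x := by
    intro v _
    unfold Out Ins
    rw [Fin.ext_iff, Fin.ext_iff]; omega
  have hle : S.excess (fun w => Ins (S.a x) (S.b x) w) ≤ ∑ y, if y = S.β x then 1 else 0 := by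
    refine Finset.sum_le_sum fun y _ => ?_
    by_cases h1 : Ins (S.a x) (S.b x) (S.a y)
    · rw [ind_true h1]
      rcases hout (S.b y) (S.b y) with h2 | h2 | h2 | h2
      · exact absurd (Or.inl ⟨h1, h2⟩) (hS x y)
      · rw [ind_true h2]; split_ifs <;> simp
      · exact absurd h2.symm (S.a_ne_b _ _)
      · rcases (S.b_eq x y).1 h2.symm with rfl | rfl
        · exact absurd h1 hx.1
        · rw [h2, ind_false hx.2]; simp
    · rw [ind_false h1]; unfold ind; split_ifs <;> simp
  have hge : ∑ y, -(if y = S.α x then 1 else 0) ≤ S.excess (fun w => Ins (S.a x) (S.b x) w) := by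
    refine Finset.sum_le_sum fun y _ => ?_
    by_cases h1 : Ins (S.a x) (S.b x) (S.b y)
    · rw [ind_true h1]
      rcases hout (S.a y) (S.a y) with h2 | h2 | h2 | h2
      · exact absurd (Or.inr ⟨h1, h2⟩) (hS x y)
      · rw [ind_true h2]; split_ifs <;> simp
      · rcases (S.a_eq x y).1 h2.symm with rfl | rfl
        · exact absurd h1 hx.2
        · rw [h2, ind_false hx.1]; simp
      · exact absurd h2 (S.a_ne_b _ _)
    · rw [ind_false h1]; unfold ind; split_ifs <;> simp
  simp only [Finset.sum_neg_distrib, Finset.sum_ite_eq', Finset.mem_univ, if_true] at hle hge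
  obtain ⟨c, hc⟩ := S.even_excess (fun w => Ins (S.a x) (S.b x) w)
  omega

theorem level_a (hS : ∀ x y, ¬ S.Cross x y)
    (x : E) : S.level (S.a x) = S.level (S.b x) := by
  have h0 := S.excess_ins_eq_zero hS x
  have h1 := S.level_of_red (S.red_a x)
  have h2 := S.level_of_not_red (S.not_red_b x)
  rcases lt_or_gt_of_ne (S.a_ne_b x x) with h | h
  · have := S.height_eq_of_lt h
    linarith
  · have h3 := S.height_eq_of_lt h
    have h4 : S.excess (fun w => Ins (S.b x) (S.a x) w) = 0 := by
      rw [← h0]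
      congr 1
      funext w
      exact propext (by unfold Ins; omega)
    linarith

theorem level_eq_of_comp_eq (hS : ∀ x y, ¬ S.Cross x y)
    {u v : Fin m} (h : S.comp u = S.comp v) : S.level u = S.level v := by
  let g : Quot (Link S.a S.b) → ℤ := Quot.lift S.level (by
    rintro _ _ ⟨x, rfl, rfl⟩
    exact S.level_a hS x)
  exact congrArg g h

theorem not_red_of_min_of_max (hS : ∀ x y, ¬ S.Cross x y)
    {i j : Fin m} (hij : S.comp i = S.comp j)
    (hi : ∀ k, S.comp k = S.comp i → i ≤ k) (hj : ∀ k, S.comp k = S.comp j → k ≤ j)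
    (hri : red i) : ¬ red j := by
  intro hrj
  have h0 : S.excess (fun w => i ≤ w ∧ w ≤ j) = 0 := by
    refine S.excess_eq_zero _ fun x => ?_
    by_cases hc : S.comp (S.a x) = S.comp i
    · have hc' : S.comp (S.b x) = S.comp i := by rw [← S.comp_a, hc]
      exact iff_of_true ⟨hi _ hc, hj _ (hc.trans hij)⟩ ⟨hi _ hc', hj _ (hc'.trans hij)⟩
    · have h1 := S.not_crs_of_comp hS hij (S.comp_a x) (Ne.symm hc)
      have h2 : S.a x ≠ i := fun h => hc (by rw [h])
      have h3 : S.a x ≠ j := fun h => hc (by rw [h, hij])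
      have h4 : S.b x ≠ i := fun h => hc (by rw [S.comp_a, h])
      have h5 : S.b x ≠ j := fun h => hc (by rw [S.comp_a, h, hij])
      have h6 := hi j hij.symm
      unfold Crs Out Ins at h1
      rw [ne_eq, Fin.ext_iff] at h2 h3 h4 h5
      rw [Fin.le_def] at h6
      simp only [Fin.le_def]
      omega
  have h1 : S.height' j = S.height i + S.excess (fun w => i ≤ w ∧ w ≤ j) :=
    S.excess_add _ _ _ fun w => by
      have h6 := hi j hij.symm
      rw [Fin.le_def] at h6
      unfold ind
      simp only [Fin.lt_def, Fin.le_def]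
      split_ifs <;> omega
  have h2 := S.level_eq_of_comp_eq hS hij
  have h3 := S.level_of_red hri
  have h4 := S.level_of_red hrj
  linarith

end ChordSystem

/-- The number of cyclically consecutive pairs of red vertices. -/
def numGaps {m : ℕ} (hm : 0 < m) (red : Fin m → Prop) : ℕ :=
  (Finset.univ.filter fun i => red i ∧ red (cycPred hm i)).card

namespace ChordSystem

variable {m : ℕ} {E : Type} {red : Fin m → Prop} (S : ChordSystem m E red)

/-- A crossing-free system with `k` components has at most `k - 1` gaps. -/
theorem numGaps_lt_numComp [Fintype E] (hS : ∀ x y, ¬ S.Cross x y) (hm : 0 < m) :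
    numGaps hm red + 1 ≤ S.numComp := by
  have hgap : ∀ i, red i → red (cycPred hm i) → S.comp i ≠ S.comp (cycPred hm i) := by
    intro i h1 h2 h
    have h3 := S.level_eq_of_comp_eq hS h
    have h4 := S.level_of_red h1
    have h5 := S.level_of_red h2
    have h6 := S.height_eq_cycPred hm i
    linarith
  have hmax : ∀ i, red i → red (cycPred hm i) → (¬ ∀ k, S.comp k = S.comp i → i ≤ k) →
      i.val ≠ 0 ∧ ∀ k, S.comp k = S.comp (cycPred hm i) → k ≤ cycPred hm i := by
    intro i h1 h2 h
    push Not at h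
    obtain ⟨d, hd, hdi⟩ := h
    rw [Fin.lt_def] at hdi
    have hv := cycPred_val hm i
    rw [if_neg (by omega)] at hv
    refine ⟨by omega, fun k hk => ?_⟩
    by_contra hlt
    rw [Fin.le_def] at hlt
    have hne := hgap i h1 h2
    have e1 : (d : ℕ) ≠ cycPred hm i := fun h => hne (by rw [← hd, Fin.ext h])
    have e2 : (k : ℕ) ≠ i := fun h => hne (by rw [← hk, Fin.ext h])
    refine S.not_crs_of_comp hS hd hk.symm (hd ▸ hne) (Or.inl ?_)
    unfold Ins Out Ins
    omega
  obtain ⟨φ, hφ, hφ'⟩ : ∃ φ : Fin m → Quot (Link S.a S.b),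
      (∀ i, (∀ k, S.comp k = S.comp i → i ≤ k) → φ i = S.comp i) ∧
      ∀ i, (¬ ∀ k, S.comp k = S.comp i → i ≤ k) → φ i = S.comp (cycPred hm i) :=
    ⟨fun i => if ∀ k, S.comp k = S.comp i → i ≤ k then S.comp i else S.comp (cycPred hm i),
      fun _ h => if_pos h, fun _ h => if_neg h⟩
  have hinj : Set.InjOn φ (Finset.univ.filter fun i => red i ∧ red (cycPred hm i) : Finset _) := by
    intro i hi j hj hij
    simp only [Finset.coe_filter, Finset.mem_univ, true_and, Set.mem_ofPred_eq] at hi hj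
    by_cases h1 : ∀ k, S.comp k = S.comp i → i ≤ k <;>
      by_cases h2 : ∀ k, S.comp k = S.comp j → j ≤ k
    · rw [hφ i h1, hφ j h2] at hij
      exact le_antisymm (h1 j hij.symm) (h2 i hij)
    · rw [hφ i h1, hφ' j h2] at hij
      exact absurd hj.2 (S.not_red_of_min_of_max hS hij h1 (hmax j hj.1 hj.2 h2).2 hi.1)
    · rw [hφ' i h1, hφ j h2] at hij
      exact absurd hi.2 (S.not_red_of_min_of_max hS hij.symm h2 (hmax i hi.1 hi.2 h1).2 hj.1)
    · rw [hφ' i h1, hφ' j h2] at hij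
      obtain ⟨h3, h4⟩ := hmax i hi.1 hi.2 h1
      obtain ⟨h5, h6⟩ := hmax j hj.1 hj.2 h2
      have h7 := le_antisymm (h6 _ hij) (h4 _ hij.symm)
      have h8 := cycPred_val hm i
      have h9 := cycPred_val hm j
      rw [if_neg h3, h7] at h8
      rw [if_neg h5] at h9
      exact Fin.ext (by omega)
  obtain ⟨c, hc⟩ : ∃ c, ∀ i, red i → red (cycPred hm i) → φ i ≠ c := by
    by_cases hz : red ⟨0, hm⟩ ∧ red (cycPred hm ⟨0, hm⟩)
    · have hl : (cycPred hm ⟨0, hm⟩).val = m - 1 := by rw [cycPred_val, if_pos rfl]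
      refine ⟨S.comp (cycPred hm ⟨0, hm⟩), fun i h1 h2 h => ?_⟩
      by_cases h3 : ∀ k, S.comp k = S.comp i → i ≤ k
      · rw [hφ i h3] at h
        refine S.not_red_of_min_of_max hS h h3 (fun k _ => ?_) h1 hz.2
        have := k.isLt
        rw [Fin.le_def]; omega
      · rw [hφ' i h3] at h
        obtain ⟨h4, h5⟩ := hmax i h1 h2 h3
        have h6 := h5 _ h.symm
        have h7 := cycPred_val hm i
        have := i.isLt
        rw [if_neg h4] at h7
        rw [Fin.le_def] at h6
        omega
    · refine ⟨S.comp ⟨0, hm⟩, fun i h1 h2 h => ?_⟩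
      by_cases h3 : ∀ k, S.comp k = S.comp i → i ≤ k
      · rw [hφ i h3] at h
        have h4 := h3 _ h.symm
        have h5 : i = ⟨0, hm⟩ := Fin.ext (Nat.le_zero.1 h4)
        exact hz (h5 ▸ ⟨h1, h2⟩)
      · rw [hφ' i h3] at h
        have hne := hgap i h1 h2
        push Not at h3
        obtain ⟨d, hd, hdi⟩ := h3
        rw [Fin.lt_def] at hdi
        have hv := cycPred_val hm i
        rw [if_neg (by omega)] at hv
        have e1 : (d : ℕ) ≠ cycPred hm i := fun h => hne (by rw [← hd, Fin.ext h])
        have e2 : (d : ℕ) ≠ 0 := fun h' => hne (by rw [← hd, h]; congr 1; exact Fin.ext h')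
        refine S.not_crs_of_comp hS h.symm hd (by rw [hd, ← h]; exact hne.symm) (Or.inl ?_)
        unfold Ins Out Ins
        simp only
        omega
  have : Fintype (Quot (Link S.a S.b)) := Fintype.ofFinite _
  unfold numComp numGaps
  rw [Nat.card_eq_fintype_card, ← Finset.card_image_of_injOn hinj, ← Finset.card_univ]
  refine Finset.card_lt_card (Finset.ssubset_univ_iff.2 fun h => ?_)
  obtain ⟨i, hi, hic⟩ := Finset.mem_image.1 (h ▸ Finset.mem_univ c)
  simp only [Finset.mem_filter, Finset.mem_univ, true_and] at hi
  exact hc i hi.1 hi.2 hic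

end ChordSystem

section SumSplit

variable {E : Type} [Fintype E] {e f : E}

theorem sum_eq_sum_erase_erase (hef : e ≠ f) (g : E → ℕ) :
    ∑ x, g x = g e + g f + ∑ x ∈ (Finset.univ.erase e).erase f, g x := by
  rw [add_assoc, Finset.add_sum_erase _ _ (by simp [hef.symm]),
    Finset.add_sum_erase _ _ (Finset.mem_univ e)]

theorem sum_sum_eq_of_symm (hef : e ≠ f) (w : E → E → ℕ) (hw : ∀ x y, w x y = w y x)
    (hw' : ∀ x, w x x = 0) :
    ∑ x, ∑ y, w x y = 2 * w e f +
      2 * ∑ x ∈ (Finset.univ.erase e).erase f, (w x e + w x f) +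
      ∑ x ∈ (Finset.univ.erase e).erase f, ∑ y ∈ (Finset.univ.erase e).erase f, w x y := by
  have h : ∀ z, ∑ x ∈ (Finset.univ.erase e).erase f, w z x =
      ∑ x ∈ (Finset.univ.erase e).erase f, w x z := fun z => Finset.sum_congr rfl fun x _ => hw z x
  simp only [sum_eq_sum_erase_erase hef, Finset.sum_add_distrib, hw', h e, h f]
  rw [hw f e]
  ring

end SumSplit

namespace ChordSystem

variable {m : ℕ} {E : Type} {red : Fin m → Prop} (S : ChordSystem m E red)

theorem Cross.symm {S : ChordSystem m E red} {x y : E} (h : S.Cross x y) : S.Cross y x := Crs.symm h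

theorem not_cross_self (x : E) : ¬ S.Cross x x := by
  unfold Cross Crs Out Ins
  omega

/-- The crossing indicator of two edges. -/
def cr (x y : E) : ℕ := if S.Cross x y then 1 else 0

theorem cr_comm (x y : E) : S.cr x y = S.cr y x := by
  unfold cr
  rw [propext (⟨Cross.symm, Cross.symm⟩ : S.Cross x y ↔ S.Cross y x)]

theorem cr_self (x : E) : S.cr x x = 0 := if_neg (S.not_cross_self x)

theorem cr_swap_of_ne {e f x y : E} (hx : x ≠ e) (hx' : x ≠ f) (hy : y ≠ e) (hy' : y ≠ f) :
    (S.swap e f).cr x y = S.cr x y := by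
  unfold cr Cross
  rw [S.swap_b_of_ne hx hx', S.swap_b_of_ne hy hy']
  rfl

theorem Cross.ne {S : ChordSystem m E red} {e f : E} (h : S.Cross e f) : e ≠ f := fun hef => S.not_cross_self f (hef ▸ h)

theorem Cross.cr_swap {S : ChordSystem m E red} {e f : E} (h : S.Cross e f) : (S.swap e f).cr e f = 0 := by
  refine if_neg fun h' => Crs.not_exchange h ?_
  unfold Cross at h'
  rwa [S.swap_b_left, S.swap_b_right] at h'

theorem Cross.cr_swap_add_le {S : ChordSystem m E red} {e f : E} (h : S.Cross e f) (x : E) (he : x ≠ e) (hf : x ≠ f) :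
    (S.swap e f).cr x e + (S.swap e f).cr x f ≤ S.cr x e + S.cr x f := by
  unfold cr
  have h1 : (S.swap e f).Cross x e → S.Cross x e ∨ S.Cross x f := by
    unfold Cross
    rw [S.swap_b_left, S.swap_b_of_ne he hf]
    exact Crs.or_of_exchange h
  have h2 : (S.swap e f).Cross x f → S.Cross x e ∨ S.Cross x f := by
    unfold Cross
    rw [S.swap_b_right, S.swap_b_of_ne he hf]
    exact fun h' => (Crs.or_of_exchange h.symm h').symm
  have h3 : (S.swap e f).Cross x e → (S.swap e f).Cross x f → S.Cross x e ∧ S.Cross x f := by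
    unfold Cross
    rw [S.swap_b_left, S.swap_b_right, S.swap_b_of_ne he hf]
    exact fun h1 h2 => ⟨Crs.of_exchange h h1 h2, Crs.of_exchange h.symm h2 h1⟩
  split_ifs <;> first | omega | tauto

variable [Fintype E]

/-- The number of ordered pairs of crossing edges. -/
def crossSum : ℕ := ∑ x, ∑ y, S.cr x y

theorem crossSum_swap_le {e f : E} (hef : e ≠ f)
    (h : ∀ x, x ≠ e → x ≠ f → (S.swap e f).cr x e + (S.swap e f).cr x f ≤ S.cr x e + S.cr x f)
    (T : Finset E) (he : e ∉ T) (hf : f ∉ T) :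
    (S.swap e f).crossSum + 2 * S.cr e f + 2 * ∑ x ∈ T, (S.cr x e + S.cr x f) ≤
      S.crossSum + 2 * (S.swap e f).cr e f +
        2 * ∑ x ∈ T, ((S.swap e f).cr x e + (S.swap e f).cr x f) := by
  have hT : T ⊆ (Finset.univ.erase e).erase f := fun x hx => by
    simp only [Finset.mem_erase, Finset.mem_univ, and_true]
    exact ⟨fun h => hf (h ▸ hx), fun h => he (h ▸ hx)⟩
  unfold crossSum
  rw [sum_sum_eq_of_symm hef _ S.cr_comm S.cr_self,
    sum_sum_eq_of_symm hef _ (S.swap e f).cr_comm (S.swap e f).cr_self]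
  have h1 : ∑ x ∈ (Finset.univ.erase e).erase f, ∑ y ∈ (Finset.univ.erase e).erase f,
      (S.swap e f).cr x y =
      ∑ x ∈ (Finset.univ.erase e).erase f, ∑ y ∈ (Finset.univ.erase e).erase f, S.cr x y := by
    refine Finset.sum_congr rfl fun x hx => Finset.sum_congr rfl fun y hy => ?_
    simp only [Finset.mem_erase, Finset.mem_univ, and_true] at hx hy
    exact S.cr_swap_of_ne hx.2 hx.1 hy.2 hy.1
  have h3 := Finset.sum_sdiff (f := fun x => S.cr x e + S.cr x f) hT
  have h4 := Finset.sum_sdiff (f := fun x => (S.swap e f).cr x e + (S.swap e f).cr x f) hT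
  rw [h1]
  have h2 : ∑ x ∈ (Finset.univ.erase e).erase f \ T,
      ((S.swap e f).cr x e + (S.swap e f).cr x f) ≤
      ∑ x ∈ (Finset.univ.erase e).erase f \ T, (S.cr x e + S.cr x f) := by
    refine Finset.sum_le_sum fun x hx => ?_
    simp only [Finset.mem_sdiff, Finset.mem_erase, Finset.mem_univ, and_true] at hx
    exact h x hx.1.2 hx.1.1
  omega

theorem Cross.crossSum_swap {S : ChordSystem m E red} {e f : E} (h : S.Cross e f) (T : Finset E) (he : e ∉ T) (hf : f ∉ T) :
    (S.swap e f).crossSum + 2 + 2 * ∑ x ∈ T, (S.cr x e + S.cr x f) ≤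
      S.crossSum + 2 * ∑ x ∈ T, ((S.swap e f).cr x e + (S.swap e f).cr x f) := by
  have h1 := S.crossSum_swap_le h.ne h.cr_swap_add_le T he hf
  rw [h.cr_swap, show S.cr e f = 1 from if_pos h] at h1
  omega

theorem Cross.crossSum_swap_le {S : ChordSystem m E red} {e f : E} (h : S.Cross e f) : (S.swap e f).crossSum + 2 ≤ S.crossSum := by
  simpa using h.crossSum_swap ∅ (by simp) (by simp)

/-- Crossings and components together account for all gaps. -/
theorem numGaps_le (hm : 0 < m) (S : ChordSystem m E red) :
    2 * numGaps hm red + 2 ≤ S.crossSum + 2 * S.numComp := by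
  induction hk : S.crossSum using Nat.strong_induction_on generalizing S with
  | _ k ih =>
    by_cases hS : ∀ x y, ¬ S.Cross x y
    · have := S.numGaps_lt_numComp hS hm
      omega
    · push Not at hS
      obtain ⟨e, f, h⟩ := hS
      have h1 := h.crossSum_swap_le
      have h2 := S.numComp_swap_le e f
      have h3 := ih _ (by omega) (S.swap e f) rfl
      omega

end ChordSystem

theorem not_crs_parallel {p q x y x' y' : ℕ} (hx : Ins p q x) (hy : Out p q y)
    (hx' : Out p q x') (hy' : Ins p q y') : ¬ Crs x y' x' y := by
  unfold Crs Out Ins at *; grind (splits := 60)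

namespace ChordSystem

variable {m : ℕ} {E : Type} {red : Fin m → Prop} {S : ChordSystem m E red}

theorem Cross.b_ne {e f : E} (h : S.Cross e f) : S.b e ≠ S.b f := by
  rw [ne_eq, Fin.ext_iff]
  unfold Cross Crs Out Ins at h
  omega

/-- The edges carry signs that alternate along the components. -/
structure IsSign (S : ChordSystem m E red) (s : E → ℤ) : Prop where
  α_eq : ∀ x, s (S.α x) = - s x
  β_eq : ∀ x, s (S.β x) = - s x
  eq_or : ∀ x, s x = 1 ∨ s x = -1

theorem IsSign.ne_zero {s : E → ℤ} (hs : S.IsSign s) (x : E) : s x ≠ 0 := by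
  have := hs.eq_or x
  omega

theorem IsSign.eq_of_a_eq {s : E → ℤ} (hs : S.IsSign s) {x y : E} (h : s y = s x)
    (h' : S.a y = S.a x) : y = x := by
  refine ((S.a_eq x y).1 h'.symm).resolve_right ?_
  rintro rfl
  have := hs.α_eq x
  have := hs.ne_zero x
  omega

theorem IsSign.eq_of_b_eq {s : E → ℤ} (hs : S.IsSign s) {x y : E} (h : s y = s x)
    (h' : S.b y = S.b x) : y = x := by
  refine ((S.b_eq x y).1 h'.symm).resolve_right ?_
  rintro rfl
  have := hs.β_eq x
  have := hs.ne_zero x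
  omega

variable [Fintype E]

/-- The system has as few crossings as its number of components allows. -/
def IsTight (hm : 0 < m) (S : ChordSystem m E red) : Prop :=
  S.crossSum + 2 * S.numComp = 2 * numGaps hm red + 2

variable {hm : 0 < m} {e f g : E}

theorem IsTight.comp_swap_ne (hS : S.IsTight hm) (h : S.Cross e f) :
    (S.swap e f).comp (S.a e) ≠ (S.swap e f).comp (S.a f) := fun hc => by
  have h1 := S.numComp_swap_le_of_comp_eq hc
  have h2 := h.crossSum_swap_le
  have h3 := numGaps_le hm (S.swap e f)
  unfold IsTight at hS
  omega

theorem IsTight.comp_eq (hS : S.IsTight hm) (h : S.Cross e f) :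
    S.comp (S.a e) = S.comp (S.a f) := by
  by_contra hc
  have h1 := S.numComp_swap_lt hc
  have h2 := h.crossSum_swap_le
  have h3 := numGaps_le hm (S.swap e f)
  unfold IsTight at hS
  omega

theorem IsTight.swap (hS : S.IsTight hm) (h : S.Cross e f) : (S.swap e f).IsTight hm := by
  have h1 := S.numComp_swap_le e f
  have h2 := h.crossSum_swap_le
  have h3 := numGaps_le hm (S.swap e f)
  unfold IsTight at *
  omega

theorem IsTight.cr_swap_add (hS : S.IsTight hm) (h : S.Cross e f) (he : g ≠ e) (hf : g ≠ f) :
    S.cr g e + S.cr g f ≤ (S.swap e f).cr g e + (S.swap e f).cr g f := by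
  have h1 := S.numComp_swap_le e f
  have h2 := h.crossSum_swap {g} (by simpa using he.symm) (by simpa using hf.symm)
  have h3 := numGaps_le hm (S.swap e f)
  rw [Finset.sum_singleton, Finset.sum_singleton] at h2
  unfold IsTight at hS
  omega

theorem IsTight.not_cross (hS : S.IsTight hm) (hf : S.Cross e f) (hg : S.Cross e g) :
    ¬ S.Cross f g := fun h => by
  have h1 := hS.cr_swap_add hf hg.ne.symm h.ne.symm
  rw [show S.cr g e = 1 from if_pos hg.symm, show S.cr g f = 1 from if_pos h.symm] at h1
  have h2 : (S.swap e f).Cross e g ∧ (S.swap e f).Cross f g := by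
    unfold cr at h1
    split_ifs at h1 with h2 h3 <;> first | omega | exact ⟨h2.symm, h3.symm⟩
  have hS' := hS.swap hf
  exact hS.comp_swap_ne hf ((hS'.comp_eq h2.1).trans (hS'.comp_eq h2.2).symm)

theorem IsTight.sign_eq (hS : S.IsTight hm) {s : E → ℤ} (hs : S.IsSign s) (h : S.Cross e f) :
    s f = s e := by
  by_contra hne
  refine hS.comp_swap_ne h (S.comp_swap_eq_of_sign hs.α_eq hs.β_eq hs.ne_zero ?_ h.b_ne)
  have := hs.eq_or e
  have := hs.eq_or f
  omega

/-- If an edge has two crossings, then it is crossed in both directions. -/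
theorem IsTight.exists_cross (hS : S.IsTight hm) {s : E → ℤ} (hs : S.IsSign s)
    (hf : S.Cross e f) (hg : S.Cross e g) (hfg : f ≠ g) (P : Fin m → Prop)
    (ha : ¬ P (S.a e)) (hb : ¬ P (S.b e))
    (hP : ∀ x, S.a x ≠ S.a e → S.b x ≠ S.b e → (S.Cross e x ↔ ¬ (P (S.a x) ↔ P (S.b x)))) :
    ∃ x, S.Cross e x ∧ ¬ P (S.a x) ∧ P (S.b x) := by
  by_contra! hne
  have hα : ∑ x, s x * ind (P (S.a x)) = 0 := by
    refine Finset.sum_involution (fun x _ => S.α x) ?_ ?_ ?_ ?_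
    · intro x _
      rw [S.a_α, hs.α_eq]; ring
    · intro x _ _; exact S.α_ne x
    · intro x _; exact Finset.mem_univ _
    · intro x _; exact S.α_α x
  have hβ : ∑ x, s x * ind (P (S.b x)) = 0 := by
    refine Finset.sum_involution (fun x _ => S.β x) ?_ ?_ ?_ ?_
    · intro x _
      rw [S.b_β, hs.β_eq]; ring
    · intro x _ _; exact S.β_ne x
    · intro x _; exact Finset.mem_univ _
    · intro x _; exact S.β_β x
  have h0 : ∑ x, s e * (s x * ind (P (S.a x)) - s x * ind (P (S.b x))) = 0 := by
    rw [← Finset.mul_sum, Finset.sum_sub_distrib, hα, hβ]; ring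
  have h1 : ∀ x, (if x = f then 1 else 0) + (if x = g then 1 else 0) -
      (if x = S.β e then 1 else 0) ≤ s e * (s x * ind (P (S.a x)) - s x * ind (P (S.b x))) := by
    intro x
    have hsβ := hs.β_eq e
    have hse := hs.ne_zero e
    have hsf := hS.sign_eq hs hf
    have hsg := hS.sign_eq hs hg
    have hsq : s e * s e = 1 := by rcases hs.eq_or e with h | h <;> rw [h] <;> norm_num
    by_cases hx : s x = s e
    · rw [if_neg (c := x = S.β e) (by rintro rfl; omega), hx, ← mul_sub, ← mul_assoc, hsq,
        one_mul, sub_zero]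
      by_cases hxe : x = e
      · rw [if_neg (by rw [hxe]; exact hf.ne), if_neg (by rw [hxe]; exact hg.ne), hxe,
          ind_false ha, ind_false hb]
        norm_num
      · have hPx := hP x (fun h => hxe (hs.eq_of_a_eq hx h)) (fun h => hxe (hs.eq_of_b_eq hx h))
        by_cases hc : S.Cross e x
        · have h2 := hne x hc
          have h3 := hPx.1 hc
          rw [ind_true (by tauto), ind_false (by tauto)]
          split_ifs with h4 h5
          · exact absurd (h4.symm.trans h5) hfg
          all_goals norm_num
        · rw [if_neg (by rintro rfl; exact hc hf), if_neg (by rintro rfl; exact hc hg)]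
          rw [propext (not_not.1 (mt hPx.2 hc))]
          simp
    · have hx' : s x = - s e := by
        have := hs.eq_or e
        have := hs.eq_or x
        omega
      rw [if_neg (c := x = f) (by rintro rfl; exact hx hsf),
        if_neg (c := x = g) (by rintro rfl; exact hx hsg), hx', ← mul_sub, ← mul_assoc,
        mul_neg, hsq]
      by_cases hxβ : x = S.β e
      · rw [if_pos hxβ, hxβ, S.b_β, ind_false hb]
        unfold ind
        split_ifs <;> norm_num
      · rw [if_neg hxβ]
        have hxe : x ≠ e := by rintro rfl; exact hx rfl
        by_cases hxa : S.a x = S.a e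
        · rw [hxa, ind_false ha]
          unfold ind
          split_ifs <;> norm_num
        · have hPx := hP x hxa fun h => ((S.b_eq e x).1 h.symm).elim hxe hxβ
          rw [propext (not_not.1 (mt hPx.2 fun hc => hx (hS.sign_eq hs hc)))]
          simp
  have h2 := Finset.sum_le_sum fun x (_ : x ∈ Finset.univ) => h1 x
  rw [h0, Finset.sum_sub_distrib, Finset.sum_add_distrib] at h2
  simp at h2

theorem IsTight.not_cross_both (hS : S.IsTight hm) {s : E → ℤ} (hs : S.IsSign s)
    (haf : Ins (S.a e) (S.b e) (S.a f)) (hbf : Out (S.a e) (S.b e) (S.b f))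
    (hag : Out (S.a e) (S.b e) (S.a g)) (hbg : Ins (S.a e) (S.b e) (S.b g)) : False := by
  induction hk : ((S.a f : ℤ) - S.b g).natAbs using Nat.strong_induction_on generalizing f g with
  | _ k ih =>
    have hf : S.Cross e f := Or.inl ⟨haf, hbf⟩
    have hg : S.Cross e g := Or.inr ⟨hbg, hag⟩
    have hfg : f ≠ g := by rintro rfl; exact hag.1 haf
    have hsf := hS.sign_eq hs hf
    have hsg := hS.sign_eq hs hg
    have hab : ∀ x y, (S.a x : ℕ) ≠ S.b y := fun x y h => S.a_ne_b x y (Fin.ext h)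
    by_cases hex : ∃ h, h ≠ f ∧ h ≠ g ∧
        CrsBetween (S.a e) (S.b e) (S.a f) (S.b g) (S.a h) (S.b h)
    · obtain ⟨h, hhf, hhg, ⟨h1, h2, h3⟩ | ⟨h1, h2, h3⟩⟩ := hex
      · have hsh := hS.sign_eq hs (f := h) (Or.inl ⟨h1, h2⟩)
        have h4 : (S.a h : ℕ) ≠ S.a f := fun h' =>
          hhf (hs.eq_of_a_eq (hsh.trans hsf.symm) (Fin.ext h'))
        have h5 := (h3.resolve_right (by have := hab h g; omega))
        refine ih _ ?_ h1 h2 hag hbg rfl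
        unfold Ins at h5
        omega
      · have hsh := hS.sign_eq hs (f := h) (Or.inr ⟨h1, h2⟩)
        have h4 : (S.b h : ℕ) ≠ S.b g := fun h' =>
          hhg (hs.eq_of_b_eq (hsh.trans hsg.symm) (Fin.ext h'))
        have h5 := (h3.resolve_right (by have := hab f h; omega))
        refine ih _ ?_ haf hbf h2 h1 rfl
        unfold Ins at h5
        omega
    · push Not at hex
      have hle : ∀ x, x ≠ f → x ≠ g →
          (S.swap f g).cr x f + (S.swap f g).cr x g ≤ S.cr x f + S.cr x g := by
        intro x hxf hxg
        have hx := hex x hxf hxg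
        have h1 : (S.swap f g).Cross x f → S.Cross x f ∨ S.Cross x g := by
          unfold Cross
          rw [S.swap_b_left, S.swap_b_of_ne hxf hxg]
          intro h
          have := crs_parallel_inner haf hbf hag hbg (hS.not_cross hf hg) (hab f g) (hab g f) h
          tauto
        have h2 : (S.swap f g).Cross x g → S.Cross x f ∨ S.Cross x g := by
          unfold Cross
          rw [S.swap_b_right, S.swap_b_of_ne hxf hxg]
          intro h
          have := crs_parallel_outer haf hbf hag hbg (hab f g) (hab g f) h
          tauto
        have h3 : (S.swap f g).Cross x f → (S.swap f g).Cross x g → S.Cross x f ∧ S.Cross x g := by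
          unfold Cross
          rw [S.swap_b_left, S.swap_b_right, S.swap_b_of_ne hxf hxg]
          intro h h'
          have := crs_parallel_both haf hbf hag hbg h h'
          tauto
        unfold cr
        split_ifs <;> first | omega | tauto
      have h1 := S.crossSum_swap_le hfg hle {e} (by simpa using hf.ne.symm)
        (by simpa using hg.ne.symm)
      have h2 : (S.swap f g).cr f g = 0 := by
        refine if_neg ?_
        unfold Cross
        rw [S.swap_b_left, S.swap_b_right]
        exact not_crs_parallel haf hbf hag hbg
      have h3 : (S.swap f g).cr e f = 0 := by
        refine if_neg ?_
        unfold Cross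
        rw [S.swap_b_left, S.swap_b_of_ne hf.ne hg.ne]
        rintro (h | h)
        exacts [h.2.1 hbg, h.2.1 haf]
      have h4 : (S.swap f g).cr e g = 0 := by
        refine if_neg ?_
        unfold Cross
        rw [S.swap_b_right, S.swap_b_of_ne hf.ne hg.ne]
        rintro (h | h)
        exacts [hag.1 h.1, hbf.1 h.1]
      rw [Finset.sum_singleton, Finset.sum_singleton, h2, h3, h4,
        show S.cr e f = 1 from if_pos hf, show S.cr e g = 1 from if_pos hg] at h1
      have h5 := S.numComp_swap_le f g
      have h6 := numGaps_le hm (S.swap f g)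
      unfold IsTight at hS
      omega

/-- Every edge of a tight system has at most one crossing. -/
theorem IsTight.cross_unique (hS : S.IsTight hm) {s : E → ℤ} (hs : S.IsSign s)
    (hf : S.Cross e f) (hg : S.Cross e g) : f = g := by
  by_contra hfg
  obtain ⟨x, hx, hx1, hx2⟩ := hS.exists_cross hs hf hg hfg
    (fun v => Ins (S.a e) (S.b e) v) (by unfold Ins; omega) (by unfold Ins; omega) (by
      intro x h1 h2
      have h3 := S.a_ne_b x e
      have h4 := (S.a_ne_b e x).symm
      rw [ne_eq, Fin.ext_iff] at h1 h2 h3 h4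
      unfold Cross Crs Out
      tauto)
  obtain ⟨y, hy, hy1, hy2⟩ := hS.exists_cross hs hf hg hfg
    (fun v => Out (S.a e) (S.b e) v) (by unfold Out; omega) (by unfold Out; omega) (by
      intro x h1 h2
      have h3 := S.a_ne_b x e
      have h4 := (S.a_ne_b e x).symm
      rw [ne_eq, Fin.ext_iff] at h1 h2 h3 h4
      unfold Cross Crs Out
      simp only [ne_eq, h1, h2, h3, h4, not_false_eq_true, and_true, not_iff_not]
      tauto)
  have hx3 : Out (S.a e) (S.b e) (S.a x) := by
    rcases hx with h | h
    exacts [absurd h.1 hx1, h.2]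
  have hy3 : Ins (S.a e) (S.b e) (S.a y) := by
    rcases hy with h | h
    exacts [h.1, absurd h.2 hy1]
  exact hS.not_cross_both hs hy3 hy2 hx3 hx2

end ChordSystem

theorem cycSucc_val {m : ℕ} (hm : 0 < m) (i : Fin m) :
    (cycSucc hm i).val = if i.val + 1 = m then 0 else i.val + 1 := by
  have := i.isLt
  unfold cycSucc
  split_ifs with h
  · simp only [h, Nat.mod_self]
  · exact Nat.mod_eq_of_lt (by omega)

/-- The cyclic rotation of `Fin m`. -/
def cycPerm {m : ℕ} (hm : 0 < m) : Equiv.Perm (Fin m) where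
  toFun := cycSucc hm
  invFun := cycPred hm
  left_inv i := by
    have h := cycSucc_val hm i
    refine Fin.ext ((cycPred_val hm _).trans ?_)
    split_ifs at h ⊢ <;> omega
  right_inv i := by
    have := i.isLt
    have h := cycPred_val hm i
    refine Fin.ext ((cycSucc_val hm _).trans ?_)
    split_ifs at h ⊢ <;> omega

namespace ChordSystem

section OfCycle

variable {m : ℕ} {E : Type} {red : Fin m → Prop}

/-- The chord system of an alternating cycle with vertices `pos i`, where the edge `i` joins
`pos i` to `pos (σ i)`. -/
def ofCycle (pos : E ≃ Fin m) (σ : Equiv.Perm E) (hc : ∀ i, red (pos (σ i)) ↔ ¬ red (pos i)) :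
    ChordSystem m E red :=
  have hc' : ∀ i, red (pos (σ.symm i)) ↔ ¬ red (pos i) := fun i => by
    have := hc (σ.symm i)
    rw [σ.apply_symm_apply] at this
    tauto
  { a := fun i => if red (pos i) then pos i else pos (σ i)
    b := fun i => if red (pos i) then pos (σ i) else pos i
    α := fun i => if red (pos i) then σ.symm i else σ i
    β := fun i => if red (pos i) then σ i else σ.symm i
    red_a := fun i => by
      split_ifs with h
      exacts [h, (hc i).2 h]
    not_red_b := fun i => by
      split_ifs with h
      exacts [fun h' => (hc i).1 h' h, h]
    surj_a := fun v hv => ⟨pos.symm v, by simp [hv]⟩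
    surj_b := fun v hv => ⟨pos.symm v, by simp [hv]⟩
    α_α := fun i => by by_cases h : red (pos i) <;> simp [h, hc, hc']
    β_β := fun i => by by_cases h : red (pos i) <;> simp [h, hc, hc']
    α_ne := fun i h => by
      split_ifs at h with h3
      · exact (hc' i).1 (by rw [h]; exact h3) h3
      · have := (hc i).2 h3
        rw [h] at this
        exact h3 this
    β_ne := fun i h => by
      split_ifs at h with h3
      · exact (hc i).1 (by rw [h]; exact h3) h3
      · have := (hc' i).2 h3
        rw [h] at this
        exact h3 this
    a_eq := fun x y => by
      have hx := hc x
      have hy := hc y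
      by_cases h1 : red (pos x) <;> by_cases h2 : red (pos y) <;>
        simp only [h1, h2, if_true, if_false, pos.apply_eq_iff_eq, σ.apply_eq_iff_eq,
          Equiv.eq_symm_apply]
      · refine ⟨fun h => Or.inl h.symm, ?_⟩
        rintro (h | rfl)
        exacts [h.symm, absurd h1 (by tauto)]
      · refine ⟨fun h => Or.inr h.symm, ?_⟩
        rintro (rfl | h)
        exacts [absurd h1 h2, h.symm]
      · refine ⟨fun h => Or.inr h.symm, ?_⟩
        rintro (rfl | h)
        exacts [absurd h2 h1, h.symm]
      · refine ⟨fun h => Or.inl h.symm, ?_⟩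
        rintro (h | rfl)
        exacts [h.symm, absurd (hx.2 h1) h2]
    b_eq := fun x y => by
      have hx := hc x
      have hy := hc y
      by_cases h1 : red (pos x) <;> by_cases h2 : red (pos y) <;>
        simp only [h1, h2, if_true, if_false, pos.apply_eq_iff_eq, σ.apply_eq_iff_eq,
          Equiv.eq_symm_apply]
      · refine ⟨fun h => Or.inl h.symm, ?_⟩
        rintro (h | rfl)
        exacts [h.symm, absurd h1 (by tauto)]
      · refine ⟨fun h => Or.inr h.symm, ?_⟩
        rintro (rfl | h)
        exacts [absurd h1 h2, h.symm]
      · refine ⟨fun h => Or.inr h.symm, ?_⟩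
        rintro (rfl | h)
        exacts [absurd h2 h1, h.symm]
      · refine ⟨fun h => Or.inl h.symm, ?_⟩
        rintro (h | rfl)
        exacts [h.symm, absurd (by tauto) h1] }

variable (pos : E ≃ Fin m) (σ : Equiv.Perm E) (hc : ∀ i, red (pos (σ i)) ↔ ¬ red (pos i))

theorem isSign_ofCycle : (ofCycle pos σ hc).IsSign fun i => if red (pos i) then 1 else -1 := by
  have hc' : ∀ i, red (pos (σ.symm i)) ↔ ¬ red (pos i) := fun i => by
    have := hc (σ.symm i)
    rw [σ.apply_symm_apply] at this
    tauto
  refine ⟨fun i => ?_, fun i => ?_, fun i => ?_⟩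
  · by_cases h : red (pos i) <;> simp [ofCycle, h, hc, hc']
  · by_cases h : red (pos i) <;> simp [ofCycle, h, hc, hc']
  · split_ifs <;> simp

theorem cross_ofCycle {i j : E} :
    (ofCycle pos σ hc).Cross i j ↔ Crs (pos i) (pos (σ i)) (pos j) (pos (σ j)) := by
  unfold Cross ofCycle
  simp only
  split_ifs
  exacts [Iff.rfl, ⟨Crs.right_comm, Crs.right_comm⟩, ⟨Crs.left_comm, Crs.left_comm⟩,
    ⟨fun h => h.left_comm.right_comm, fun h => h.left_comm.right_comm⟩]

theorem comp_ofCycle (i : E) :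
    (ofCycle pos σ hc).comp (pos (σ i)) = (ofCycle pos σ hc).comp (pos i) := by
  have h := (ofCycle pos σ hc).comp_a i
  simp only [ofCycle] at h
  split_ifs at h
  exacts [h.symm, h]

end OfCycle

theorem numComp_ofCycle {m : ℕ} {red : Fin m → Prop} (hm : 0 < m) (pos : Fin m ≃ Fin m)
    (hc : ∀ i, red (pos (cycPerm hm i)) ↔ ¬ red (pos i)) :
    (ofCycle pos (cycPerm hm) hc).numComp = 1 := by
  have h : ∀ k (hk : k < m), (ofCycle pos (cycPerm hm) hc).comp (pos ⟨k, hk⟩) =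
      (ofCycle pos (cycPerm hm) hc).comp (pos ⟨0, hm⟩) := by
    intro k
    induction k with
    | zero => exact fun _ => rfl
    | succ k ih =>
      intro hk
      rw [← ih (by omega), ← comp_ofCycle pos _ hc ⟨k, by omega⟩]
      congr 2
      exact (Fin.ext (Nat.mod_eq_of_lt hk)).symm
  refine Nat.card_eq_one_iff_exists.2
    ⟨(ofCycle pos (cycPerm hm) hc).comp (pos ⟨0, hm⟩), fun q => ?_⟩
  induction q using Quot.ind with
  | _ v =>
    rw [← h _ (pos.symm v).isLt, Fin.eta, pos.apply_symm_apply]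
    rfl

theorem crossSum_eq_two_mul {m : ℕ} {E : Type} {red : Fin m → Prop} [Fintype E] [LinearOrder E]
    (S : ChordSystem m E red) :
    S.crossSum =
      2 * (Finset.univ.filter fun p : E × E => p.1 < p.2 ∧ S.Cross p.1 p.2).card := by
  have h : ∀ x y, S.cr x y = (if x < y ∧ S.Cross x y then 1 else 0) +
      (if y < x ∧ S.Cross y x then 1 else 0) := by
    intro x y
    rcases lt_trichotomy x y with h | rfl | h
    · simp [h, h.not_gt, cr]
    · simp [S.cr_self]
    · rw [S.cr_comm]
      simp [h, h.not_gt, cr]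
  unfold crossSum
  simp only [h, Finset.sum_add_distrib]
  rw [Finset.sum_comm (f := fun x y => if y < x ∧ S.Cross y x then 1 else 0), ← two_mul,
    Finset.card_filter, Fintype.sum_prod_type]

end ChordSystem

theorem SegCross.symm {e f : Pt × Pt} (h : SegCross e f) : SegCross f e :=
  let ⟨x, hx, hx'⟩ := h
  ⟨x, hx', hx⟩

theorem SegCross.left_comm {p q : Pt} {f : Pt × Pt} (h : SegCross (p, q) f) :
    SegCross (q, p) f := by
  obtain ⟨x, hx, hx'⟩ := h
  exact ⟨x, by rwa [openSegment_symm], hx'⟩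

theorem SegCross.right_comm {e : Pt × Pt} {p q : Pt} (h : SegCross e (p, q)) :
    SegCross e (q, p) := h.symm.left_comm.symm

/-- The diagonals of a convex quadrilateral cross. -/
theorem segCross_of_det2 {p q r s : Pt} (h₁ : det2 p q s < 0) (h₂ : det2 q r s < 0)
    (h₃ : det2 p q r < 0) (h₄ : det2 p r s < 0) : SegCross (p, r) (q, s) := by
  have hw : det2 q r s + det2 p q s = det2 p r s + det2 p q r := by unfold det2; ring
  have hne : det2 q r s + det2 p q s ≠ 0 := by linarith
  refine ⟨(det2 q r s / (det2 q r s + det2 p q s)) • p +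
    (det2 p q s / (det2 q r s + det2 p q s)) • r, ⟨_, _, ?_, ?_, ?_, rfl⟩,
    ⟨det2 p r s / (det2 q r s + det2 p q s), det2 p q r / (det2 q r s + det2 p q s),
      ?_, ?_, ?_, ?_⟩⟩
  · exact div_pos_of_neg_of_neg h₂ (by linarith)
  · exact div_pos_of_neg_of_neg h₁ (by linarith)
  · rw [← add_div, div_self hne]
  · exact div_pos_of_neg_of_neg h₄ (by linarith)
  · exact div_pos_of_neg_of_neg h₃ (by linarith)
  · rw [← add_div, hw, div_self (hw ▸ hne)]
  · ext
    · simp only [Prod.fst_add, Prod.smul_fst, smul_eq_mul]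
      field_simp
      unfold det2; ring
    · simp only [Prod.snd_add, Prod.smul_snd, smul_eq_mul]
      field_simp
      unfold det2; ring

/-- Interleaving chords of a convex polygon cross. -/
theorem CWList.segCross {m : ℕ} {pt : Fin m → Pt} (h : CWList pt) {p q u v : Fin m}
    (hc : Crs p q u v) : SegCross (pt p, pt q) (pt u, pt v) := by
  wlog hpq : p < q generalizing p q
  · rcases eq_or_ne p q with rfl | hne
    · unfold Crs Out Ins at hc
      omega
    · exact (this hc.left_comm (lt_of_le_of_ne (not_lt.1 hpq) hne.symm)).left_comm
  wlog hu : Ins p q u generalizing u v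
  · rcases hc with hc | hc
    · exact absurd hc.1 hu
    · exact (this (Or.inl hc) hc.1).right_comm
  have hv : Out p q v := by
    rcases hc with hc | hc
    exacts [hc.2, absurd hu hc.2.1]
  unfold Out Ins at hv
  unfold Ins at hu
  rw [Fin.lt_def] at hpq
  have h1 : p < u := Fin.lt_def.2 (by omega)
  have h2 : u < q := Fin.lt_def.2 (by omega)
  rcases lt_or_ge q v with h3 | h3
  · exact segCross_of_det2 (h.2 _ _ _ h1 (h2.trans h3)) (h.2 _ _ _ h2 h3) (h.2 _ _ _ h1 h2)
      (h.2 _ _ _ (h1.trans h2) h3)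
  · rw [Fin.le_def] at h3
    have h4 : v < p := Fin.lt_def.2 (by omega)
    exact (segCross_of_det2 (h.2 _ _ _ h4 (h1.trans h2)) (h.2 _ _ _ h1 h2) (h.2 _ _ _ h4 h1)
      (h.2 _ _ _ (h4.trans h1) h2)).left_comm.symm

theorem numGaps_add_runCount {R B : Finset Pt} (hdisj : Disjoint R B) (hB : B.Nonempty) {m : ℕ}
    (hm : 0 < m) {pt : Fin m → Pt} (hpt : Function.Injective pt)
    (hcover : Finset.univ.image pt = R ∪ B) :
    numGaps hm (fun w => pt w ∈ R) + runCount hm R B pt = R.card := by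
  have hmem : ∀ i, pt i ∈ B ↔ pt i ∉ R := fun i => by
    have h1 : pt i ∈ R ∪ B := hcover ▸ Finset.mem_image_of_mem pt (Finset.mem_univ i)
    refine ⟨fun h h' => Finset.disjoint_left.1 hdisj h' h, fun h => ?_⟩
    exact (Finset.mem_union.1 h1).resolve_left h
  have hsurj : ∀ p ∈ R ∪ B, ∃ i, pt i = p := fun p hp => by
    rw [← hcover] at hp
    simpa using hp
  obtain ⟨p, hp⟩ := hB
  obtain ⟨i, rfl⟩ := hsurj p (Finset.mem_union_right _ hp)
  have hR : (Finset.univ.filter fun i => pt i ∈ R).image pt = R := by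
    ext p
    simp only [Finset.mem_image, Finset.mem_filter, Finset.mem_univ, true_and]
    refine ⟨fun ⟨j, hj, h⟩ => h ▸ hj, fun h => ?_⟩
    obtain ⟨j, rfl⟩ := hsurj p (Finset.mem_union_left _ h)
    exact ⟨j, h, rfl⟩
  unfold runCount numGaps
  rw [if_neg fun h => (hmem i).1 hp (h i)]
  conv_rhs => rw [← hR]
  rw [Finset.card_image_of_injective _ hpt,
    ← Finset.card_filter_add_card_filter_not (s := Finset.univ.filter fun i => pt i ∈ R)
      (fun i => pt (cycPred hm i) ∈ R), Finset.filter_filter, Finset.filter_filter]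
  simp only [hmem]

/-- Theorem 3.1(ii): for `S = R ∪ B` in convex position (listed clockwise by `pt`) with
`|R| = |B| = n ≥ 2`, every Hamiltonian alternating cycle on `S` having exactly
`n − r(S)` crossings is 1-plane. -/
theorem stmt7 (n : ℕ) (hn : 2 ≤ n) (R B : Finset Pt)
    (hdisj : Disjoint R B)
    (hR : R.card = n) (hB : B.card = n)
    (m : ℕ) (hm : 0 < m) (pt : Fin m → Pt)
    (hcw : CWList pt) (hcover : Finset.univ.image pt = R ∪ B) :
    ∀ C : HamAltCycle R B,
      crossNum (cycleEdges C.verts) = n - runCount hm R B pt →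
      OnePlane (cycleEdges C.verts) := by
  intro C hC
  have hG := numGaps_add_runCount hdisj (Finset.card_pos.1 (by omega)) hm hcw.1 hcover
  have hlen : C.verts.length = m := by
    rw [← List.toFinset_card_of_nodup C.nodup, C.cover, ← hcover,
      Finset.card_image_of_injective _ hcw.1, Finset.card_fin]
  have hmem : ∀ i : Fin m, ∃ j, pt j = C.verts[i.val]'(by omega) := fun i => by
    have h : C.verts[i.val]'(by omega) ∈ Finset.univ.image pt := by
      rw [hcover, ← C.cover, List.mem_toFinset]
      exact List.getElem_mem _
    simpa using h
  choose p hp using hmem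
  have hpinj : Function.Injective p := fun i j h => by
    have h1 := hp i
    rw [h, hp j] at h1
    exact Fin.ext ((C.nodup.getElem_inj_iff).1 h1).symm
  obtain ⟨pos, hpos⟩ : ∃ pos : Fin m ≃ Fin m, ∀ i, pt (pos i) = C.verts[i.val]'(by omega) :=
    ⟨Equiv.ofBijective p (Finite.injective_iff_bijective.1 hpinj), hp⟩
  have hes : (cycleEdges C.verts).length = m := by simp [cycleEdges, hlen]
  have hget : ∀ (k : ℕ) (hk : k < m), (cycleEdges C.verts).getD k ((0, 0), (0, 0)) =
      (pt (pos ⟨k, hk⟩), pt (pos (cycPerm hm ⟨k, hk⟩))) := by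
    intro k hk
    rw [List.getD_eq_getElem _ _ (by omega), hpos, hpos]
    simp only [cycleEdges, List.getElem_zip, List.getElem_rotate, hlen]
    rfl
  have hc : ∀ i, pt (pos (cycPerm hm i)) ∈ R ↔ ¬ pt (pos i) ∈ R := by
    intro i
    have h1 := C.alt ((cycleEdges C.verts).getD i ((0, 0), (0, 0))) (by
      rw [List.getD_eq_getElem _ _ (by omega)]
      exact List.getElem_mem _)
    rw [hget i i.isLt] at h1
    rcases h1 with h1 | h1
    · exact iff_of_false (fun h => Finset.disjoint_left.1 hdisj h h1.2) (not_not.2 h1.1)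
    · exact iff_of_true h1.2 fun h => Finset.disjoint_left.1 hdisj h h1.1
  let S := ChordSystem.ofCycle (red := fun w => pt w ∈ R) pos (cycPerm hm) hc
  have hcross : ∀ i j : Fin m, S.Cross i j →
      SegCross ((cycleEdges C.verts).getD i ((0, 0), (0, 0)))
        ((cycleEdges C.verts).getD j ((0, 0), (0, 0))) := fun i j h => by
    rw [hget i i.isLt, hget j j.isLt]
    exact hcw.segCross ((ChordSystem.cross_ofCycle pos _ hc).1 h)
  have hnum : S.numComp = 1 := ChordSystem.numComp_ofCycle hm pos hc
  have hsum := S.crossSum_eq_two_mul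
  have hlow := ChordSystem.numGaps_le hm S
  unfold crossNum at hC
  rw [hes] at hC
  have himg : (Finset.univ.filter fun q : Fin m × Fin m => q.1 < q.2 ∧ S.Cross q.1 q.2).image
      (fun q => (q.1.val, q.2.val)) =
      (Finset.range m ×ˢ Finset.range m).filter (fun ij => ij.1 < ij.2 ∧
        SegCross ((cycleEdges C.verts).getD ij.1 ((0, 0), (0, 0)))
          ((cycleEdges C.verts).getD ij.2 ((0, 0), (0, 0)))) := by
    refine Finset.eq_of_subset_of_card_le (fun q hq => ?_) ?_
    · obtain ⟨⟨i, j⟩, h, rfl⟩ := Finset.mem_image.1 hq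
      simp only [Finset.mem_filter, Finset.mem_univ, true_and] at h
      simp only [Finset.mem_filter, Finset.mem_product, Finset.mem_range]
      exact ⟨⟨i.isLt, j.isLt⟩, h.1, hcross i j h.2⟩
    · rw [hC, Finset.card_image_of_injective]
      · omega
      · rintro ⟨i, j⟩ ⟨i', j'⟩ h
        simp only [Prod.mk.injEq] at h
        exact Prod.ext (Fin.ext h.1) (Fin.ext h.2)
  have hcard := congrArg Finset.card himg
  rw [hC, Finset.card_image_of_injective _ (by
    rintro ⟨i, j⟩ ⟨i', j'⟩ h
    simp only [Prod.mk.injEq] at h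
    exact Prod.ext (Fin.ext h.1) (Fin.ext h.2))] at hcard
  have htight : S.IsTight hm := by
    unfold ChordSystem.IsTight
    omega
  have hcross' : ∀ i j, i < m → j < m → i < j →
      SegCross ((cycleEdges C.verts).getD i ((0, 0), (0, 0)))
        ((cycleEdges C.verts).getD j ((0, 0), (0, 0))) →
      ∃ i' j' : Fin m, i'.val = i ∧ j'.val = j ∧ S.Cross i' j' := by
    intro i j hi hj hij h
    have h1 : (i, j) ∈ (Finset.range m ×ˢ Finset.range m).filter (fun ij => ij.1 < ij.2 ∧
        SegCross ((cycleEdges C.verts).getD ij.1 ((0, 0), (0, 0)))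
          ((cycleEdges C.verts).getD ij.2 ((0, 0), (0, 0)))) := by
      simp only [Finset.mem_filter, Finset.mem_product, Finset.mem_range]
      exact ⟨⟨hi, hj⟩, hij, h⟩
    rw [← himg] at h1
    obtain ⟨⟨i', j'⟩, h2, h3⟩ := Finset.mem_image.1 h1
    simp only [Prod.mk.injEq] at h3
    simp only [Finset.mem_filter, Finset.mem_univ, true_and] at h2
    exact ⟨i', j', h3.1, h3.2, h2.2⟩
  have hcross'' : ∀ i j : Fin m, j.val ≠ i.val →
      SegCross ((cycleEdges C.verts).getD i ((0, 0), (0, 0)))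
        ((cycleEdges C.verts).getD j ((0, 0), (0, 0))) → S.Cross i j := by
    intro i j hij h
    rcases lt_or_gt_of_ne hij with h' | h'
    · obtain ⟨i', j', h1, h2, h3⟩ := hcross' _ _ j.isLt i.isLt h' h.symm
      rw [Fin.ext h1, Fin.ext h2] at h3
      exact h3.symm
    · obtain ⟨i', j', h1, h2, h3⟩ := hcross' _ _ i.isLt j.isLt h' h
      rwa [Fin.ext h1, Fin.ext h2] at h3
  intro i hi
  unfold edgeCrossCount
  rw [hes] at hi ⊢
  rw [Finset.mem_range] at hi
  refine Finset.card_le_one.2 fun j hj k hk => ?_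
  simp only [Finset.mem_filter, Finset.mem_range] at hj hk
  have h := htight.cross_unique (ChordSystem.isSign_ofCycle pos _ hc)
    (hcross'' ⟨i, hi⟩ ⟨j, hj.1⟩ hj.2.1 hj.2.2) (hcross'' ⟨i, hi⟩ ⟨k, hk.1⟩ hk.2.1 hk.2.2)
  exact congrArg Fin.val h
end
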